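/- The third derivative of ξ satisfies ξ'''(t) < 0 for t in (−π/2, 0) and ξ'''(t) > 0 for t in (0, π/2); moreover ξ'''(t) tends to 8π/15 as t tends to π/2 from the left. -/

import Mathlib

open Real Set Filter Topology

noncomputable def xi (t : ℝ) : ℝ :=
  (Real.cos t ^ 2 + 2 * t * Real.sin t * Real.cos t + t ^ 2 - Real.pi ^ 2 / 4) / Real.cos t ^ 2

noncomputable def eta (t : ℝ) : ℝ :=
  ((4 / Real.pi) * t + (4 / Real.pi) * Real.cos t * Real.sin t - 2 * Real.sin t) / Real.cos t ^ 2

/-- The third derivative of `xi`, multiplied by `cos ^ 5 / 8`. -/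
noncomputable def xiThirdNum (t : ℝ) : ℝ :=
  3 * sin t * cos t ^ 2 + 2 * t * cos t * (1 + 2 * sin t ^ 2)
    - (π ^ 2 / 4 - t ^ 2) * (sin t * (2 + sin t ^ 2))

lemma hasDerivAt_xi {t : ℝ} (hc : cos t ≠ 0) :
    HasDerivAt xi (2 * sin t / cos t + 4 * t / cos t ^ 2
      - 2 * (π ^ 2 / 4 - t ^ 2) * sin t / cos t ^ 3) t := by
  have hs := hasDerivAt_sin t
  have hcos := hasDerivAt_cos t
  have hid := hasDerivAt_id' t
  have h := (((((hcos.pow 2).add (((hid.const_mul 2).mul hs).mul hcos)).add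
    (hid.pow 2)).sub_const (π ^ 2 / 4))).div (hcos.pow 2) (pow_ne_zero 2 hc)
  refine h.congr_deriv ?_
  simp only [Pi.add_apply, Pi.mul_apply, Pi.pow_apply]
  field_simp
  norm_num
  have h3 : sin t ^ 2 = 1 - cos t ^ 2 := by linarith [sin_sq_add_cos_sq t]
  ring_nf
  simp only [h3]
  ring_nf

lemma hasDerivAt_xi_deriv {t : ℝ} (hc : cos t ≠ 0) :
    HasDerivAt (fun t => 2 * sin t / cos t + 4 * t / cos t ^ 2
      - 2 * (π ^ 2 / 4 - t ^ 2) * sin t / cos t ^ 3)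
      (6 / cos t ^ 2 + 12 * t * sin t / cos t ^ 3
        - 2 * (π ^ 2 / 4 - t ^ 2) * (3 - 2 * cos t ^ 2) / cos t ^ 4) t := by
  have hs := hasDerivAt_sin t
  have hcos := hasDerivAt_cos t
  have hid := hasDerivAt_id' t
  have h := (((hs.const_mul 2).div hcos hc).add
    ((hid.const_mul 4).div (hcos.pow 2) (pow_ne_zero 2 hc))).sub
    (((((hid.pow 2).const_sub (π ^ 2 / 4)).const_mul 2).mul hs).div (hcos.pow 3)
      (pow_ne_zero 3 hc))
  refine h.congr_deriv ?_
  simp only [Pi.mul_apply, Pi.pow_apply]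
  field_simp
  norm_num
  have h3 : sin t ^ 2 = 1 - cos t ^ 2 := by linarith [sin_sq_add_cos_sq t]
  ring_nf
  simp only [h3]
  ring_nf

lemma hasDerivAt_xi_deriv_deriv {t : ℝ} (hc : cos t ≠ 0) :
    HasDerivAt (fun t => 6 / cos t ^ 2 + 12 * t * sin t / cos t ^ 3
        - 2 * (π ^ 2 / 4 - t ^ 2) * (3 - 2 * cos t ^ 2) / cos t ^ 4)
      (8 * xiThirdNum t / cos t ^ 5) t := by
  have hs := hasDerivAt_sin t
  have hcos := hasDerivAt_cos t
  have hid := hasDerivAt_id' t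
  have h := (((hasDerivAt_const t (6 : ℝ)).div (hcos.pow 2) (pow_ne_zero 2 hc)).add
    (((hid.const_mul 12).mul hs).div (hcos.pow 3) (pow_ne_zero 3 hc))).sub
    (((((hid.pow 2).const_sub (π ^ 2 / 4)).const_mul 2).mul
      (((hcos.pow 2).const_mul 2).const_sub 3)).div (hcos.pow 4) (pow_ne_zero 4 hc))
  refine h.congr_deriv ?_
  simp only [Pi.mul_apply, Pi.pow_apply, xiThirdNum]
  field_simp
  norm_num
  have h3 : sin t ^ 2 = 1 - cos t ^ 2 := by linarith [sin_sq_add_cos_sq t]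
  have h4 : sin t ^ 3 = sin t * (1 - cos t ^ 2) := by rw [← h3]; ring
  ring_nf
  simp only [h3, h4]
  ring_nf

lemma deriv_deriv_deriv_xi {t : ℝ} (ht : cos t ≠ 0) :
    deriv (deriv (deriv xi)) t = 8 * xiThirdNum t / cos t ^ 5 := by
  have hopen : IsOpen {t : ℝ | cos t ≠ 0} := isOpen_ne_fun continuous_cos continuous_const
  have h1 : ∀ x, cos x ≠ 0 → deriv xi =ᶠ[𝓝 x] _ := fun x hx =>
    eventually_of_mem (hopen.mem_nhds hx) fun _ hy => (hasDerivAt_xi hy).deriv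
  have h2 : deriv (deriv xi) =ᶠ[𝓝 t] _ :=
    eventually_of_mem (hopen.mem_nhds ht) fun y hy =>
      (h1 y hy).deriv_eq.trans (hasDerivAt_xi_deriv hy).deriv
  exact h2.deriv_eq.trans (hasDerivAt_xi_deriv_deriv ht).deriv

lemma xiThirdNum_neg (t : ℝ) : xiThirdNum (-t) = -xiThirdNum t := by
  simp only [xiThirdNum, sin_neg, cos_neg]
  ring

/-- The quotient of `xiThirdNum` by `sin * (2 + sin ^ 2)`, whose derivative has a simple
closed form. -/
noncomputable def xiThirdQuot (t : ℝ) : ℝ :=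
  (3 * sin t * cos t ^ 2 + 2 * t * cos t * (1 + 2 * sin t ^ 2)) / (sin t * (2 + sin t ^ 2))
    - (π ^ 2 / 4 - t ^ 2)

lemma xiThirdNum_eq {t : ℝ} (hs : sin t ≠ 0) :
    xiThirdNum t = xiThirdQuot t * (sin t * (2 + sin t ^ 2)) := by
  have h : 2 + sin t ^ 2 ≠ 0 := by positivity
  simp only [xiThirdNum, xiThirdQuot]
  field_simp

lemma hasDerivAt_xiThirdQuot {t : ℝ} (h0 : sin t ≠ 0) :
    HasDerivAt xiThirdQuot (cos t ^ 4 * (4 * cos t * sin t - 2 * t * (1 + cos t ^ 2)) /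
      (sin t * (2 + sin t ^ 2)) ^ 2) t := by
  have hs := hasDerivAt_sin t
  have hcos := hasDerivAt_cos t
  have hid := hasDerivAt_id' t
  have hp : 2 + sin t ^ 2 ≠ 0 := by positivity
  have h := ((((hs.const_mul 3).mul (hcos.pow 2)).add
    (((hid.const_mul 2).mul hcos).mul (((hs.pow 2).const_mul 2).const_add 1))).div
    (hs.mul ((hs.pow 2).const_add 2)) (mul_ne_zero h0 hp)).sub
    ((hid.pow 2).const_sub (π ^ 2 / 4))
  refine h.congr_deriv ?_
  simp only [Pi.add_apply, Pi.mul_apply, Pi.pow_apply]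
  have h3 : cos t ^ 2 = 1 - sin t ^ 2 := by linarith [sin_sq_add_cos_sq t]
  have h4 : cos t ^ 3 = cos t * (1 - sin t ^ 2) := by rw [← h3]; ring
  have h5 : cos t ^ 4 = (1 - sin t ^ 2) ^ 2 := by rw [← h3]; ring
  field_simp
  norm_num
  ring_nf
  have h6 : cos t ^ 5 = cos t * (1 - sin t ^ 2) ^ 2 := by rw [← h3]; ring
  have h7 : cos t ^ 6 = (1 - sin t ^ 2) ^ 3 := by rw [← h3]; ring
  simp only [h3, h4, h5, h6, h7]
  ring_nf

lemma xiThirdQuot_pi_div_two : xiThirdQuot (π / 2) = 0 := by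
  simp [xiThirdQuot]
  ring

lemma xiThirdQuot_strictAntiOn : StrictAntiOn xiThirdQuot (Ioc 0 (π / 2)) := by
  have hsin : ∀ t ∈ Ioc 0 (π / 2), 0 < sin t := fun t ht =>
    sin_pos_of_pos_of_lt_pi ht.1 (by linarith [ht.2, pi_pos])
  refine strictAntiOn_of_deriv_neg (convex_Ioc _ _) (fun t ht =>
    (hasDerivAt_xiThirdQuot (hsin t ht).ne').continuousAt.continuousWithinAt) fun t ht => ?_
  rw [interior_Ioc] at ht
  have hs := hsin t (Ioo_subset_Ioc_self ht)
  have hc : 0 < cos t := cos_pos_of_mem_Ioo ⟨by linarith [ht.1, pi_pos], ht.2⟩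
  rw [(hasDerivAt_xiThirdQuot hs.ne').deriv]
  refine div_neg_of_neg_of_pos (mul_neg_of_pos_of_neg (by positivity) ?_) (by positivity)
  nlinarith [mul_nonneg hs.le (sq_nonneg (1 - cos t)),
    mul_pos (sub_pos.2 (sin_lt ht.1)) (show 0 < 1 + cos t ^ 2 by positivity)]

lemma xiThirdNum_pos {t : ℝ} (ht : t ∈ Ioo 0 (π / 2)) : 0 < xiThirdNum t := by
  have hs : 0 < sin t := sin_pos_of_pos_of_lt_pi ht.1 (by linarith [ht.2, pi_pos])
  have h := xiThirdQuot_strictAntiOn (Ioo_subset_Ioc_self ht)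
    (right_mem_Ioc.2 (by positivity)) ht.2
  rw [xiThirdQuot_pi_div_two] at h
  rw [xiThirdNum_eq hs.ne']
  positivity

lemma tendsto_xiThirdQuot_div_cos_pow :
    Tendsto (fun t => xiThirdQuot t / cos t ^ 5) (𝓝[<] (π / 2)) (𝓝 (π / 45)) := by
  have hev : ∀ᶠ t in 𝓝[<] (π / 2), t ∈ Ioo 0 (π / 2) := Ioo_mem_nhdsLT (by positivity)
  have hs : ∀ t ∈ Ioo 0 (π / 2), 0 < sin t := fun t ht =>
    sin_pos_of_pos_of_lt_pi ht.1 (by linarith [ht.2, pi_pos])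
  have hc : ∀ t ∈ Ioo 0 (π / 2), 0 < cos t := fun t ht =>
    cos_pos_of_mem_Ioo ⟨by linarith [ht.1, pi_pos], ht.2⟩
  refine HasDerivAt.lhopital_zero_nhdsLT
    (hev.mono fun t ht => hasDerivAt_xiThirdQuot (hs t ht).ne')
    (hev.mono fun t _ => (hasDerivAt_cos t).pow 5)
    (hev.mono fun t ht => ?_) ?_ ?_ ?_
  · have := hs t ht
    have := hc t ht
    simp only [mul_neg, ne_eq, neg_eq_zero]
    positivity
  · have h := (hasDerivAt_xiThirdQuot (t := π / 2) (by simp)).continuousAt.tendsto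
    rw [xiThirdQuot_pi_div_two] at h
    exact h.mono_left nhdsWithin_le_nhds
  · have h : Tendsto (fun t => cos t ^ 5) (𝓝 (π / 2)) (𝓝 (cos (π / 2) ^ 5)) :=
      (continuous_cos.pow 5).tendsto _
    rw [cos_pi_div_two, zero_pow (by norm_num)] at h
    exact h.mono_left nhdsWithin_le_nhds
  · have hcont : ContinuousAt (fun t => (2 * t * (1 + cos t ^ 2) - 4 * cos t * sin t) /
        (5 * sin t ^ 3 * (2 + sin t ^ 2) ^ 2)) (π / 2) :=
      ContinuousAt.div (by fun_prop) (by fun_prop) (by norm_num)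
    have h := hcont.tendsto.mono_left (nhdsWithin_le_nhds (s := Iio (π / 2)))
    have hval : (2 * (π / 2) * (1 + cos (π / 2) ^ 2) - 4 * cos (π / 2) * sin (π / 2)) /
        (5 * sin (π / 2) ^ 3 * (2 + sin (π / 2) ^ 2) ^ 2) = π / 45 := by
      rw [cos_pi_div_two, sin_pi_div_two]
      ring
    rw [hval] at h
    refine h.congr' (hev.mono fun t ht => ?_)
    have := (hs t ht).ne'
    have := (hc t ht).ne'
    have : 2 + sin t ^ 2 ≠ 0 := by positivity
    norm_num
    field_simp
    ring

theorem xi_third_deriv :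
    (∀ t ∈ Set.Ioo (-(Real.pi / 2)) (0 : ℝ), deriv (deriv (deriv xi)) t < 0) ∧
    (∀ t ∈ Set.Ioo (0 : ℝ) (Real.pi / 2), 0 < deriv (deriv (deriv xi)) t) ∧
    Filter.Tendsto (deriv (deriv (deriv xi)))
      (nhdsWithin (Real.pi / 2) (Set.Iio (Real.pi / 2))) (nhds (8 * Real.pi / 15)) := by
  refine ⟨fun t ht => ?_, fun t ht => ?_, ?_⟩
  · have hc : 0 < cos t := cos_pos_of_mem_Ioo ⟨ht.1, by linarith [ht.2, pi_pos]⟩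
    have h := xiThirdNum_pos (t := -t) ⟨by linarith [ht.2], by linarith [ht.1]⟩
    rw [xiThirdNum_neg] at h
    rw [deriv_deriv_deriv_xi hc.ne']
    exact div_neg_of_neg_of_pos (by linarith) (by positivity)
  · have hc : 0 < cos t := cos_pos_of_mem_Ioo ⟨by linarith [ht.1, pi_pos], ht.2⟩
    have h := xiThirdNum_pos ht
    rw [deriv_deriv_deriv_xi hc.ne']
    positivity
  · have hcont : Tendsto (fun t => 8 * (sin t * (2 + sin t ^ 2))) (𝓝[<] (π / 2))
        (𝓝 (8 * (sin (π / 2) * (2 + sin (π / 2) ^ 2)))) :=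
      ((by fun_prop : Continuous fun t => 8 * (sin t * (2 + sin t ^ 2))).tendsto _).mono_left
        nhdsWithin_le_nhds
    have h := hcont.mul tendsto_xiThirdQuot_div_cos_pow
    have hval : 8 * (sin (π / 2) * (2 + sin (π / 2) ^ 2)) * (π / 45) = 8 * π / 15 := by
      rw [sin_pi_div_two]
      ring
    rw [hval] at h
    have hev : ∀ᶠ t in 𝓝[<] (π / 2), t ∈ Ioo 0 (π / 2) := Ioo_mem_nhdsLT (by positivity)
    refine h.congr' (hev.mono fun t ht => ?_)
    have hs : 0 < sin t := sin_pos_of_pos_of_lt_pi ht.1 (by linarith [ht.2, pi_pos])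
    have hc : 0 < cos t := cos_pos_of_mem_Ioo ⟨by linarith [ht.1, pi_pos], ht.2⟩
    rw [deriv_deriv_deriv_xi hc.ne', xiThirdNum_eq hs.ne']
    ring
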